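/- Let 1 < q < ∞ and suppose α/n > β/m and (α+ρβ)/(n+ρm) = 1 − 1/q. Then there exists a constant C, depending only on n, m, α, β, ρ, q (and not on L or a), such that ∑_{k≥1} ∑_{ℓ≥1} ∬_{Q_{kℓ}} |I a(x,y)|^q dx dy ≤ C for every L ∈ ℤ and every measurable a supported in ½Q with |a| ≤ 2^{(n+m)(1−L)} pointwise and ∬ a(x,y) dx dy = 0. -/

import Mathlib

open MeasureTheory

/-- The flag kernel `Ω(x,y) = |x|^(α-n) (|x|^ρ + |y|)^(β-m)` on `ℝ^n × ℝ^m`. -/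
noncomputable def flagKernel (n m : ℕ) (α β ρ : ℝ)
    (x : EuclideanSpace ℝ (Fin n)) (y : EuclideanSpace ℝ (Fin m)) : ℝ :=
  ‖x‖ ^ (α - (n : ℝ)) * (‖x‖ ^ ρ + ‖y‖) ^ (β - (m : ℝ))

/-- The fractional integral operator `I f(x,y) = ∬ f(u,v) Ω(x-u, y-v) du dv`. -/
noncomputable def flagOp (n m : ℕ) (α β ρ : ℝ)
    (f : EuclideanSpace ℝ (Fin n) × EuclideanSpace ℝ (Fin m) → ℝ)
    (z : EuclideanSpace ℝ (Fin n) × EuclideanSpace ℝ (Fin m)) : ℝ :=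
  ∫ w : EuclideanSpace ℝ (Fin n) × EuclideanSpace ℝ (Fin m),
    f w * flagKernel n m α β ρ (z.1 - w.1) (z.2 - w.2)

/-- The `ℓ^∞` (sup) norm `‖x‖_∞` of a point of Euclidean space. -/
noncomputable def supAbs {n : ℕ} (x : EuclideanSpace ℝ (Fin n)) : ℝ :=
  ‖(WithLp.equiv 2 (Fin n → ℝ)) x‖

lemma abs_rpow_sub_rpow_le_of_nonpos {e P p p' : ℝ} (he : e ≤ 0) (hP : 0 < P) (hp : P ≤ p)
    (hp' : P ≤ p') : |p' ^ e - p ^ e| ≤ -e * P ^ (e - 1) * |p' - p| := by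
  refine Convex.norm_image_sub_le_of_norm_hasDerivWithin_le (f := fun x : ℝ ↦ x ^ e)
    (f' := fun x ↦ e * x ^ (e - 1)) (s := Set.Ici P) (fun x hx ↦ ?_) (fun x hx ↦ ?_)
    (convex_Ici P) hp hp'
  · exact (Real.hasDerivAt_rpow_const (Or.inl (hP.trans_le hx).ne')).hasDerivWithinAt
  · have hx0 : 0 < x := hP.trans_le hx
    rw [Real.norm_eq_abs, abs_mul, abs_of_nonpos he, abs_of_pos (Real.rpow_pos_of_pos hx0 _)]
    exact mul_le_mul_of_nonneg_left (Real.rpow_le_rpow_of_nonpos hP hx (by linarith)) (by linarith)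

lemma abs_rpow_sub_rpow_le_of_one_le {ρ M p p' : ℝ} (hρ : 1 ≤ ρ) (hp : 0 ≤ p) (hpM : p ≤ M)
    (hp' : 0 ≤ p') (hpM' : p' ≤ M) : |p' ^ ρ - p ^ ρ| ≤ ρ * M ^ (ρ - 1) * |p' - p| := by
  refine Convex.norm_image_sub_le_of_norm_hasDerivWithin_le (f := fun x : ℝ ↦ x ^ ρ)
    (f' := fun x ↦ ρ * x ^ (ρ - 1)) (s := Set.Icc 0 M) (fun x hx ↦ ?_) (fun x hx ↦ ?_)
    (convex_Icc 0 M) ⟨hp, hpM⟩ ⟨hp', hpM'⟩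
  · exact (Real.hasDerivAt_rpow_const (Or.inr hρ)).hasDerivWithinAt
  · rw [Real.norm_eq_abs, abs_mul, abs_of_nonneg (by linarith),
      abs_of_nonneg (Real.rpow_nonneg hx.1 _)]
    exact mul_le_mul_of_nonneg_left (Real.rpow_le_rpow hx.1 hx.2 (by linarith)) (by linarith)

/-- Smoothness of the profile `r ^ e₁ * (r ^ ρ + h) ^ e₂` of a flag kernel at scales `X`, `Y`. -/
lemma exists_abs_flagProfile_sub_le {e₁ e₂ ρ κ : ℝ} (he₁ : e₁ < 0) (he₂ : e₂ < 0) (hρ : 1 ≤ ρ)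
    (hκ : 1 ≤ κ) :
    ∃ C : ℝ, 0 < C ∧ ∀ X Y l r r' h h' : ℝ, 0 < X → 0 < Y → 0 < l →
      X / κ ≤ r → r ≤ κ * X → X / κ ≤ r' → r' ≤ κ * X → Y / κ ≤ h → Y / κ ≤ h' →
      |r' - r| ≤ κ * l → |h' - h| ≤ κ * l →
      |r' ^ e₁ * (r' ^ ρ + h') ^ e₂ - r ^ e₁ * (r ^ ρ + h) ^ e₂| ≤
        C * (X ^ e₁ * (X ^ ρ + Y) ^ e₂ * (l / X + l / Y)) := by
  have hκ0 : 0 < κ := by linarith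
  set c : ℝ := (κ ^ ρ)⁻¹ with hc
  have hc0 : 0 < c := by positivity
  have h1 : 0 < -e₁ := by linarith
  have h2 : 0 < -e₂ := by linarith
  set A : ℝ := -e₁ * (κ⁻¹ ^ (e₁ - 1) * κ * c ^ e₂) with hA
  set B : ℝ := κ⁻¹ ^ e₁ * (-e₂ * c ^ (e₂ - 1)) with hB
  set D : ℝ := ρ * κ ^ (ρ - 1) * κ with hD
  have hA0 : 0 < A := by positivity
  have hB0 : 0 < B := by positivity
  have hD0 : 0 < D := by positivity
  refine ⟨A + B * (D + κ), by positivity, ?_⟩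
  intro X Y l r r' h h' hX hY hl hr hrX hr' hrX' hh hh' hrr hhh
  set T : ℝ := X ^ ρ + Y with hT
  have hT0 : 0 < T := by positivity
  have hXκ : 0 < X / κ := by positivity
  have hYκ : 0 < Y / κ := by positivity
  have hg : ∀ {r h : ℝ}, X / κ ≤ r → Y / κ ≤ h → c * T ≤ r ^ ρ + h := by
    intro r h hr hh
    have a1 : (X / κ) ^ ρ ≤ r ^ ρ := Real.rpow_le_rpow hXκ.le hr (by linarith)
    rw [Real.div_rpow hX.le hκ0.le] at a1
    have a2 : Y * c ≤ Y / κ := by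
      have : c ≤ κ⁻¹ := inv_anti₀ hκ0 (Real.self_le_rpow_of_one_le hκ hρ)
      rw [div_eq_mul_inv]
      gcongr
    have a3 : c * T = X ^ ρ / κ ^ ρ + Y * c := by rw [hc, hT]; ring
    linarith
  have hg1 := hg hr hh
  have hg2 := hg hr' hh'
  have hcT : 0 < c * T := by positivity
  have hr0 : 0 < r := hXκ.trans_le hr
  have hr0' : 0 < r' := hXκ.trans_le hr'
  have hdg : |(r' ^ ρ + h') - (r ^ ρ + h)| ≤ D * (X ^ (ρ - 1) * l) + κ * l := by
    have b1 := abs_rpow_sub_rpow_le_of_one_le hρ hr0.le hrX hr0'.le hrX'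
    have b2 : ρ * (κ * X) ^ (ρ - 1) * |r' - r| ≤ ρ * (κ * X) ^ (ρ - 1) * (κ * l) := by gcongr
    have b3 : ρ * (κ * X) ^ (ρ - 1) * (κ * l) = D * (X ^ (ρ - 1) * l) := by
      rw [Real.mul_rpow hκ0.le hX.le, hD]; ring
    calc _ = |(r' ^ ρ - r ^ ρ) + (h' - h)| := by ring_nf
      _ ≤ |r' ^ ρ - r ^ ρ| + |h' - h| := abs_add_le _ _
      _ ≤ _ := by linarith
  have t1 : |r' ^ e₁ - r ^ e₁| * (r' ^ ρ + h') ^ e₂ ≤ A * (X ^ e₁ * T ^ e₂ * (l / X)) := by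
    calc _ ≤ (-e₁ * (X / κ) ^ (e₁ - 1) * (κ * l)) * (c * T) ^ e₂ := by
          refine mul_le_mul ?_ (Real.rpow_le_rpow_of_nonpos hcT hg2 he₂.le)
            (Real.rpow_nonneg (hcT.trans_le hg2).le _) (by positivity)
          refine (abs_rpow_sub_rpow_le_of_nonpos he₁.le hXκ hr hr').trans ?_
          gcongr
      _ = _ := by
          rw [div_eq_mul_inv, Real.mul_rpow hX.le (by positivity), Real.mul_rpow hc0.le hT0.le,
            Real.rpow_sub_one hX.ne', hA]
          ring
  have t2 : r ^ e₁ * |(r' ^ ρ + h') ^ e₂ - (r ^ ρ + h) ^ e₂| ≤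
      B * (D + κ) * (X ^ e₁ * T ^ e₂ * (l / X + l / Y)) := by
    calc _ ≤ (X / κ) ^ e₁ * (-e₂ * (c * T) ^ (e₂ - 1) * (D * (X ^ (ρ - 1) * l) + κ * l)) := by
          refine mul_le_mul (Real.rpow_le_rpow_of_nonpos hXκ hr he₁.le) ?_
            (abs_nonneg _) (by positivity)
          refine (abs_rpow_sub_rpow_le_of_nonpos he₂.le hcT hg1 hg2).trans ?_
          gcongr
      _ = B * (X ^ e₁ * T ^ e₂) * (D * (X ^ ρ / T * (l / X)) + κ * (l / T)) := by
          rw [div_eq_mul_inv X κ, Real.mul_rpow hX.le (by positivity),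
            Real.mul_rpow hc0.le hT0.le, Real.rpow_sub_one hX.ne', Real.rpow_sub_one hT0.ne', hB]
          field_simp
      _ ≤ B * (X ^ e₁ * T ^ e₂) * (D * (l / X + l / Y) + κ * (l / X + l / Y)) := by
          have c1 : X ^ ρ / T ≤ 1 := by
            rw [div_le_one hT0, hT]; linarith
          have c2 : l / T ≤ l / Y := by
            have : 0 < X ^ ρ := by positivity
            gcongr; linarith
          have c3 : 0 < l / X := by positivity
          have c4 : 0 < l / Y := by positivity
          gcongr
          · nlinarith
          · linarith
      _ = _ := by ring
  have t3 : A * (X ^ e₁ * T ^ e₂ * (l / X)) ≤ A * (X ^ e₁ * T ^ e₂ * (l / X + l / Y)) := by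
    have : 0 < l / Y := by positivity
    gcongr; linarith
  calc _ = |(r' ^ e₁ - r ^ e₁) * (r' ^ ρ + h') ^ e₂ +
        r ^ e₁ * ((r' ^ ρ + h') ^ e₂ - (r ^ ρ + h) ^ e₂)| := by ring_nf
    _ ≤ |r' ^ e₁ - r ^ e₁| * (r' ^ ρ + h') ^ e₂ +
        r ^ e₁ * |(r' ^ ρ + h') ^ e₂ - (r ^ ρ + h) ^ e₂| := by
        refine (abs_add_le _ _).trans (le_of_eq ?_)
        rw [abs_mul, abs_mul, abs_of_pos (Real.rpow_pos_of_pos (hcT.trans_le hg2) _),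
          abs_of_pos (Real.rpow_pos_of_pos hr0 _)]
    _ ≤ _ := by linarith

lemma supAbs_nonneg {n : ℕ} (x : EuclideanSpace ℝ (Fin n)) : 0 ≤ supAbs x := norm_nonneg _

lemma supAbs_sub_le {n : ℕ} (x u : EuclideanSpace ℝ (Fin n)) :
    supAbs (x - u) ≤ supAbs x + supAbs u := norm_sub_le _ _

lemma supAbs_le_supAbs_sub_add {n : ℕ} (x u : EuclideanSpace ℝ (Fin n)) :
    supAbs x ≤ supAbs (x - u) + supAbs u := by
  have := norm_add_le (WithLp.equiv 2 (Fin n → ℝ) (x - u)) (WithLp.equiv 2 (Fin n → ℝ) u)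
  simpa [supAbs] using this

lemma supAbs_le_norm {n : ℕ} (x : EuclideanSpace ℝ (Fin n)) : supAbs x ≤ ‖x‖ :=
  (pi_norm_le_iff_of_nonneg (norm_nonneg _)).2 fun i ↦ PiLp.norm_apply_le x i

lemma norm_le_mul_supAbs {n : ℕ} (x : EuclideanSpace ℝ (Fin n)) : ‖x‖ ≤ n * supAbs x := by
  rw [EuclideanSpace.norm_eq]
  refine Real.sqrt_le_iff.2 ⟨by have := supAbs_nonneg x; positivity, ?_⟩
  calc ∑ i, ‖x i‖ ^ 2 ≤ ∑ _i : Fin n, supAbs x ^ 2 := by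
        refine Finset.sum_le_sum fun i _ ↦ ?_
        gcongr
        exact norm_le_pi_norm (WithLp.equiv 2 (Fin n → ℝ) x) i
    _ = n * supAbs x ^ 2 := by simp
    _ ≤ (n : ℝ) ^ 2 * supAbs x ^ 2 := by
        gcongr
        exact_mod_cast Nat.le_self_pow two_ne_zero n
    _ = _ := by ring

lemma volume_supAbs_le {n : ℕ} {r : ℝ} (hr : 0 ≤ r) :
    volume {x : EuclideanSpace ℝ (Fin n) | supAbs x ≤ r} = ENNReal.ofReal ((2 * r) ^ n) := by
  have h : {x : EuclideanSpace ℝ (Fin n) | supAbs x ≤ r} =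
      (WithLp.ofLp : EuclideanSpace ℝ (Fin n) → _) ⁻¹' Metric.closedBall 0 r := by
    ext x
    simp [supAbs]
  rw [h, (PiLp.volume_preserving_ofLp (Fin n)).measure_preimage
    Metric.isClosed_closedBall.measurableSet.nullMeasurableSet, Real.volume_pi_closedBall _ hr]
  simp

lemma volume_supAbs_prod_le {n m : ℕ} {r s : ℝ} (hr : 0 ≤ r) (hs : 0 ≤ s) :
    volume {w : EuclideanSpace ℝ (Fin n) × EuclideanSpace ℝ (Fin m) |
      supAbs w.1 ≤ r ∧ supAbs w.2 ≤ s} = ENNReal.ofReal ((2 * r) ^ n * (2 * s) ^ m) := by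
  have h : {w : EuclideanSpace ℝ (Fin n) × EuclideanSpace ℝ (Fin m) |
      supAbs w.1 ≤ r ∧ supAbs w.2 ≤ s} = {x | supAbs x ≤ r} ×ˢ {y | supAbs y ≤ s} := rfl
  rw [h, Measure.volume_eq_prod, Measure.prod_prod, volume_supAbs_le hr, volume_supAbs_le hs,
    ENNReal.ofReal_mul (by positivity)]

/-- The size of a homogeneous flag kernel on dyadic shells decays away from `t = ρ * s`. -/
lemma exists_rpow_flag_scale_le {N M α β ρ q : ℝ} (hN : 0 < N) (hM : 0 < M) (hρ : 0 < ρ)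
    (hβM : β < M) (hq : 0 < q) (hmain : β / M < α / N)
    (hhom : (α + ρ * β) / (N + ρ * M) = 1 - 1 / q) :
    ∃ ε : ℝ, 0 < ε ∧ ∀ s t : ℝ,
      ((2 : ℝ) ^ s) ^ N * ((2 : ℝ) ^ t) ^ M *
        (((2 : ℝ) ^ s) ^ (α - N) * (((2 : ℝ) ^ s) ^ ρ + (2 : ℝ) ^ t) ^ (β - M)) ^ q ≤
      (2 : ℝ) ^ (-ε * |t - ρ * s|) := by
  have hS : 0 < N + ρ * M := by positivity
  have h1 : q * (α + ρ * β) = (N + ρ * M) * (q - 1) := by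
    field_simp at hhom
    linarith
  rw [div_lt_div_iff₀ hM hN] at hmain
  have hA : 0 < q * (M - β) - M := by
    have h2 : q * β * (N + ρ * M) < M * (q - 1) * (N + ρ * M) := by
      nlinarith [mul_lt_mul_of_pos_left hmain hq]
    have := lt_of_mul_lt_mul_right h2 hS.le
    linarith
  refine ⟨min M (q * (M - β) - M), lt_min hM hA, fun s t ↦ ?_⟩
  have key : ∀ τ : ℝ, (2 : ℝ) ^ τ ≤ ((2 : ℝ) ^ s) ^ ρ + (2 : ℝ) ^ t →
      ((2 : ℝ) ^ s) ^ N * ((2 : ℝ) ^ t) ^ M *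
        (((2 : ℝ) ^ s) ^ (α - N) * (((2 : ℝ) ^ s) ^ ρ + (2 : ℝ) ^ t) ^ (β - M)) ^ q ≤
      (2 : ℝ) ^ (s * N + t * M + (s * (α - N) + τ * (β - M)) * q) := by
    intro τ hτ
    calc _ ≤ ((2 : ℝ) ^ s) ^ N * ((2 : ℝ) ^ t) ^ M *
        (((2 : ℝ) ^ s) ^ (α - N) * ((2 : ℝ) ^ τ) ^ (β - M)) ^ q := by
          have := Real.rpow_le_rpow_of_nonpos (by positivity) hτ (sub_nonpos.2 hβM.le)
          gcongr
      _ = _ := by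
          simp only [← Real.rpow_mul zero_le_two, ← Real.rpow_add zero_lt_two]
  rcases le_total (ρ * s) t with h | h
  · refine (key t (by have : 0 < ((2 : ℝ) ^ s) ^ ρ := by positivity
                      linarith)).trans ?_
    refine Real.rpow_le_rpow_of_exponent_le one_le_two ?_
    rw [abs_of_nonneg (by linarith)]
    have h3 := mul_le_mul_of_nonneg_right (min_le_right M (q * (M - β) - M)) (sub_nonneg.2 h)
    linear_combination h3 + s * h1
  · refine (key (ρ * s) (by rw [← Real.rpow_mul zero_le_two, mul_comm s ρ]
                            have : 0 < (2 : ℝ) ^ t := by positivity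
                            linarith)).trans ?_
    refine Real.rpow_le_rpow_of_exponent_le one_le_two ?_
    rw [abs_of_nonpos (by linarith)]
    have h3 := mul_le_mul_of_nonneg_right (min_le_left M (q * (M - β) - M)) (sub_nonneg.2 h)
    linear_combination h3 + s * h1

/-- Two-sided geometric sums are bounded uniformly in the centre and in the step `ρ ≥ 1`. -/
lemma exists_tsum_two_rpow_neg_abs_le {ε : ℝ} (hε : 0 < ε) :
    ∃ B : ℝ, 0 < B ∧ ∀ ρ c : ℝ, 1 ≤ ρ →
      ∑' k : ℕ, ENNReal.ofReal ((2 : ℝ) ^ (-ε * |ρ * k - c|)) ≤ ENNReal.ofReal B := by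
  have hsum : Summable fun j : ℤ ↦ (2 : ℝ) ^ (-ε * |(j : ℝ)|) := by
    have hg : Summable fun k : ℕ ↦ ((2 : ℝ) ^ (-ε)) ^ k :=
      summable_geometric_of_lt_one (by positivity)
        (Real.rpow_lt_one_of_one_lt_of_neg one_lt_two (by linarith))
    refine Summable.of_nat_of_neg ?_ ?_ <;> refine hg.congr fun k ↦ ?_ <;>
      simp [← Real.rpow_natCast, ← Real.rpow_mul]
  set S : ℝ := ∑' j : ℤ, (2 : ℝ) ^ (-ε * |(j : ℝ)|) with hS
  have hS0 : 0 < S := hsum.tsum_pos (fun _ ↦ by positivity) 0 (by positivity)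
  refine ⟨2 ^ ε * S, by positivity, fun ρ c hρ ↦ ?_⟩
  set k₀ : ℤ := ⌊c / ρ⌋ with hk₀
  have hterm : ∀ k : ℕ, (2 : ℝ) ^ (-ε * |ρ * k - c|) ≤
      2 ^ ε * 2 ^ (-ε * |(((k : ℤ) - k₀ : ℤ) : ℝ)|) := by
    intro k
    rw [← Real.rpow_add zero_lt_two]
    refine Real.rpow_le_rpow_of_exponent_le one_le_two ?_
    have h1 : |(k : ℝ) - c / ρ| ≤ |ρ * k - c| := by
      have : ρ * k - c = ρ * (k - c / ρ) := by field_simp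
      rw [this, abs_mul]
      exact le_mul_of_one_le_left (abs_nonneg _) (hρ.trans (le_abs_self ρ))
    have h2 : |(((k : ℤ) - k₀ : ℤ) : ℝ)| ≤ |(k : ℝ) - c / ρ| + 1 := by
      have h3 : |c / ρ - k₀| ≤ 1 := by
        rw [abs_le]
        constructor <;> linarith [Int.floor_le (c / ρ), Int.lt_floor_add_one (c / ρ)]
      have := abs_add_le ((k : ℝ) - c / ρ) (c / ρ - k₀)
      push_cast
      rw [sub_add_sub_cancel] at this
      linarith
    nlinarith
  calc _ ≤ ∑' k : ℕ, ENNReal.ofReal (2 ^ ε * 2 ^ (-ε * |(((k : ℤ) - k₀ : ℤ) : ℝ)|)) :=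
        ENNReal.tsum_le_tsum fun k ↦ ENNReal.ofReal_le_ofReal (hterm k)
    _ ≤ ∑' j : ℤ, ENNReal.ofReal (2 ^ ε * 2 ^ (-ε * |(j : ℝ)|)) :=
        ENNReal.tsum_comp_le_tsum_of_injective (f := fun k : ℕ ↦ (k : ℤ) - k₀)
          (fun a b h ↦ by simpa using h)
          (fun j : ℤ ↦ ENNReal.ofReal (2 ^ ε * 2 ^ (-ε * |(j : ℝ)|)))
    _ = ENNReal.ofReal (2 ^ ε * S) := by
        rw [hS, ← tsum_mul_left, ENNReal.ofReal_tsum_of_nonneg (fun _ ↦ by positivity)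
          (hsum.mul_left _)]

/-- The double series controlling the sum over shells. -/
lemma exists_tsum_tsum_shell_le {ε ρ : ℝ} (hε : 0 < ε) (hρ : 1 ≤ ρ) :
    ∃ B : ℝ, 0 < B ∧ ∀ L : ℝ,
      ∑' (k : ℕ) (l : ℕ), ENNReal.ofReal ((2 : ℝ) ^ (-ε * |L + l - ρ * (L + k)|) *
        ((1 / 2) ^ k + (1 / 2) ^ l)) ≤ ENNReal.ofReal B := by
  obtain ⟨B, hB, hsum⟩ := exists_tsum_two_rpow_neg_abs_le hε
  refine ⟨B * 2 + B * 2, by positivity, fun L ↦ ?_⟩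
  have hgeom : ∑' k : ℕ, ENNReal.ofReal ((1 / 2 : ℝ) ^ k) = ENNReal.ofReal 2 := by
    rw [← ENNReal.ofReal_tsum_of_nonneg (fun _ ↦ by positivity) summable_geometric_two,
      tsum_geometric_two]
  set F : ℕ → ℕ → ENNReal := fun k l ↦
    ENNReal.ofReal ((2 : ℝ) ^ (-ε * |L + l - ρ * (L + k)|)) with hF
  have hFl : ∀ k, ∑' l, F k l ≤ ENNReal.ofReal B := by
    intro k
    refine le_trans (le_of_eq (tsum_congr fun l ↦ ?_)) (hsum 1 (ρ * (L + k) - L) le_rfl)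
    simp only [hF]
    congr 4; ring
  have hFk : ∀ l, ∑' k, F k l ≤ ENNReal.ofReal B := by
    intro l
    refine le_trans (le_of_eq (tsum_congr fun k ↦ ?_)) (hsum ρ (L + l - ρ * L) hρ)
    simp only [hF]
    rw [abs_sub_comm]
    congr 4; ring
  calc _ = ∑' (k : ℕ) (l : ℕ), (F k l * ENNReal.ofReal ((1 / 2) ^ k) +
        F k l * ENNReal.ofReal ((1 / 2) ^ l)) := by
        refine tsum_congr fun k ↦ tsum_congr fun l ↦ ?_
        rw [ENNReal.ofReal_mul (by positivity), ENNReal.ofReal_add (by positivity) (by positivity),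
          mul_add]
    _ = (∑' k, (∑' l, F k l) * ENNReal.ofReal ((1 / 2) ^ k)) +
        ∑' l, (∑' k, F k l) * ENNReal.ofReal ((1 / 2) ^ l) := by
        simp_rw [ENNReal.tsum_add, ENNReal.tsum_mul_right]
        congr 1
        rw [ENNReal.tsum_comm]
        simp_rw [ENNReal.tsum_mul_right]
    _ ≤ (∑' k : ℕ, ENNReal.ofReal B * ENNReal.ofReal ((1 / 2) ^ k)) +
        ∑' l : ℕ, ENNReal.ofReal B * ENNReal.ofReal ((1 / 2) ^ l) := by
        gcongr
        · exact hFl _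
        · exact hFk _
    _ = _ := by
        rw [ENNReal.tsum_mul_left, hgeom, ← ENNReal.ofReal_mul hB.le,
          ENNReal.ofReal_add (by positivity) (by positivity)]

/-- Pointwise bound for `flagOp` applied to an atom, away from both coordinate axes. -/
lemma exists_abs_flagOp_atom_le {n m : ℕ} {α β ρ : ℝ} (hn : 0 < n) (hαn : α < n) (hβm : β < m)
    (hρ : 1 ≤ ρ) :
    ∃ C : ℝ, 0 < C ∧
      ∀ (L : ℤ) (a : EuclideanSpace ℝ (Fin n) × EuclideanSpace ℝ (Fin m) → ℝ),
        Measurable a →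
        (∀ w, a w ≠ 0 → max (supAbs w.1) (supAbs w.2) ≤ (2 : ℝ) ^ (L - 2)) →
        (∀ w, |a w| ≤ (2 : ℝ) ^ (((n : ℤ) + m) * (1 - L))) →
        (∫ w : EuclideanSpace ℝ (Fin n) × EuclideanSpace ℝ (Fin m), a w) = 0 →
        ∀ (X Y : ℝ) (z : EuclideanSpace ℝ (Fin n) × EuclideanSpace ℝ (Fin m)),
          (2 : ℝ) ^ L ≤ X → (2 : ℝ) ^ L ≤ Y → X ≤ supAbs z.1 → supAbs z.1 ≤ 2 * X →
          Y ≤ supAbs z.2 →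
          |flagOp n m α β ρ a z| ≤
            C * (X ^ (α - n) * (X ^ ρ + Y) ^ (β - m) * ((2 : ℝ) ^ L / X + (2 : ℝ) ^ L / Y)) := by
  have hn1 : (1 : ℝ) ≤ n := by exact_mod_cast hn
  have hm0 : (0 : ℝ) ≤ m := by positivity
  set κ : ℝ := 3 * (n + m) with hκ
  have hκ0 : 0 < κ := by positivity
  obtain ⟨C, hC, hC'⟩ := exists_abs_flagProfile_sub_le (sub_neg.2 hαn) (sub_neg.2 hβm) hρ
    (show 1 ≤ κ by linarith)
  refine ⟨C, hC, ?_⟩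
  intro L a ham hsupp hbd hmean X Y z hLX hLY hX1 hX2 hY1
  have hL0 : (0 : ℝ) < 2 ^ L := by positivity
  have hX0 : 0 < X := hL0.trans_le hLX
  have hY0 : 0 < Y := hL0.trans_le hLY
  have hL4 : (2 : ℝ) ^ (L - 2) = 2 ^ L / 4 := by
    rw [zpow_sub₀ two_ne_zero]; norm_num
  set S := {w : EuclideanSpace ℝ (Fin n) × EuclideanSpace ℝ (Fin m) |
    supAbs w.1 ≤ (2 : ℝ) ^ (L - 2) ∧ supAbs w.2 ≤ (2 : ℝ) ^ (L - 2)} with hS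
  have haS : ∀ w ∉ S, a w = 0 := fun w hw ↦ by
    by_contra h
    exact hw (max_le_iff.1 (hsupp w h))
  have hvol : volume S = ENNReal.ofReal ((2 * (2 : ℝ) ^ (L - 2)) ^ n * (2 * 2 ^ (L - 2)) ^ m) :=
    volume_supAbs_prod_le (by positivity) (by positivity)
  have hmass : (2 : ℝ) ^ (((n : ℤ) + m) * (1 - L)) * volume.real S = 1 := by
    rw [measureReal_def, hvol, ENNReal.toReal_ofReal (by positivity), ← pow_add]
    have : (2 * (2 : ℝ) ^ (L - 2)) = 2 ^ (L - 1) := by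
      rw [show L - 1 = 1 + (L - 2) by ring, zpow_add₀ two_ne_zero, zpow_one]
    rw [this, ← zpow_natCast, ← zpow_mul, ← zpow_add₀ two_ne_zero]
    rw [show ((n : ℤ) + m) * (1 - L) + (L - 1) * ((n + m : ℕ) : ℤ) = 0 by push_cast; ring, zpow_zero]
  have hvol_lt : volume S < ⊤ := by rw [hvol]; exact ENNReal.ofReal_lt_top
  have hia : Integrable a := by
    have : IntegrableOn a S := Measure.integrableOn_of_bounded hvol_lt.ne
      ham.aestronglyMeasurable (Filter.Eventually.of_forall hbd)
    exact this.integrable_of_forall_notMem_eq_zero haS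
  set K := flagKernel n m α β ρ with hK
  set R := X ^ (α - n) * (X ^ ρ + Y) ^ (β - m) * ((2 : ℝ) ^ L / X + (2 : ℝ) ^ L / Y) with hR
  have hR0 : 0 < R := by positivity
  have hker : ∀ w ∈ S, |K (z.1 - w.1) (z.2 - w.2) - K z.1 z.2| ≤ C * R := by
    rintro w ⟨hw1, hw2⟩
    rw [hL4] at hw1 hw2
    have hu := norm_le_mul_supAbs w.1
    have hv := norm_le_mul_supAbs w.2
    have hnX : (n : ℝ) * supAbs w.1 ≤ n * (2 ^ L / 4) := by gcongr
    have hmX : (m : ℝ) * supAbs w.2 ≤ m * (2 ^ L / 4) := by gcongr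
    have e1 := supAbs_sub_le z.1 w.1
    have e2 := supAbs_le_supAbs_sub_add z.1 w.1
    have e3 := supAbs_le_supAbs_sub_add z.2 w.2
    have hXκ : X / κ ≤ X / 3 := by gcongr; linarith
    have hYκ : Y / κ ≤ Y / 3 := by gcongr; linarith
    have hmX0 : 0 ≤ m * X := by positivity
    have hmL0 : 0 ≤ m * (2 : ℝ) ^ L := by positivity
    have hnL0 : 0 ≤ n * (2 : ℝ) ^ L := by positivity
    refine hC' X Y (2 ^ L) ‖z.1‖ ‖z.1 - w.1‖ ‖z.2‖ ‖z.2 - w.2‖ hX0 hY0 hL0 ?_ ?_ ?_ ?_ ?_ ?_ ?_ ?_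
    · linarith [supAbs_le_norm z.1]
    · have : (n : ℝ) * supAbs z.1 ≤ n * (3 * X) := by gcongr; linarith
      linarith [norm_le_mul_supAbs z.1]
    · linarith [supAbs_le_norm (z.1 - w.1)]
    · have : (n : ℝ) * supAbs (z.1 - w.1) ≤ n * (3 * X) := by gcongr; linarith
      linarith [norm_le_mul_supAbs (z.1 - w.1)]
    · linarith [supAbs_le_norm z.2]
    · linarith [supAbs_le_norm (z.2 - w.2)]
    · have := abs_norm_sub_norm_le (z.1 - w.1) z.1
      rw [sub_sub_cancel_left, norm_neg] at this
      linarith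
    · have := abs_norm_sub_norm_le (z.2 - w.2) z.2
      rw [sub_sub_cancel_left, norm_neg] at this
      linarith
  by_cases hi : Integrable fun w ↦ a w * K (z.1 - w.1) (z.2 - w.2)
  swap
  · rw [flagOp, integral_undef hi, abs_zero]
    positivity
  have hop : flagOp n m α β ρ a z =
      ∫ w in S, a w * (K (z.1 - w.1) (z.2 - w.2) - K z.1 z.2) := by
    rw [setIntegral_eq_integral_of_forall_compl_eq_zero (fun w hw ↦ by rw [haS w hw, zero_mul])]
    simp_rw [mul_sub]
    rw [integral_sub hi (hia.mul_const _), integral_mul_const, hmean, zero_mul, sub_zero, flagOp]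
  rw [hop, ← Real.norm_eq_abs]
  refine (norm_setIntegral_le_of_norm_le_const
    (C := (2 : ℝ) ^ (((n : ℤ) + m) * (1 - L)) * (C * R)) hvol_lt fun w hw ↦ ?_).trans
    (le_of_eq ?_)
  · rw [norm_mul]
    exact mul_le_mul (hbd w) (hker w hw) (norm_nonneg _) (by positivity)
  · linear_combination C * R * hmass

/-- Case 2 (`k > 0, ℓ > 0`): the sum over `k, ℓ ≥ 1` of the integrals of `|I a|^q`
over the dyadic shells `Q_{kℓ}` is uniformly bounded for functions `a` supported in
`½Q` with `|a| ≤ 2^{(n+m)(1-L)}` and vanishing integral. -/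
theorem flagOp_atom_case2 (n m : ℕ) (hn : 0 < n) (hm : 0 < m) (α β ρ q : ℝ)
    (hα : 0 < α) (hαn : α < n) (hβ : 0 < β) (hβm : β < m) (hρ : 1 ≤ ρ)
    (hq : 1 < q)
    (hmain : β / m < α / n)
    (hhom : (α + ρ * β) / (n + ρ * m) = 1 - 1 / q) :
    ∃ C : ℝ, 0 < C ∧
      ∀ (L : ℤ) (a : EuclideanSpace ℝ (Fin n) × EuclideanSpace ℝ (Fin m) → ℝ),
        Measurable a →
        (∀ w, a w ≠ 0 → max (supAbs w.1) (supAbs w.2) ≤ (2 : ℝ) ^ (L - 2)) →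
        (∀ w, |a w| ≤ (2 : ℝ) ^ (((n : ℤ) + m) * (1 - L))) →
        (∫ w : EuclideanSpace ℝ (Fin n) × EuclideanSpace ℝ (Fin m), a w) = 0 →
        ∑' (k : ℕ) (l : ℕ),
          ∫⁻ w in {w : EuclideanSpace ℝ (Fin n) × EuclideanSpace ℝ (Fin m) |
              ((2 : ℝ) ^ (L + ((k : ℤ) + 1) - 1) ≤ supAbs w.1 ∧
                supAbs w.1 < (2 : ℝ) ^ (L + ((k : ℤ) + 1))) ∧
              ((2 : ℝ) ^ (L + ((l : ℤ) + 1) - 1) ≤ supAbs w.2 ∧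
                supAbs w.2 < (2 : ℝ) ^ (L + ((l : ℤ) + 1)))},
            ENNReal.ofReal (|flagOp n m α β ρ a w| ^ q) ≤ ENNReal.ofReal C := by
  obtain ⟨C₀, hC₀, hpt⟩ := exists_abs_flagOp_atom_le (n := n) (m := m) hn hαn hβm hρ
  obtain ⟨ε, hε, hscale⟩ := exists_rpow_flag_scale_le (N := n) (M := m) (by exact_mod_cast hn)
    (by exact_mod_cast hm) (by linarith : 0 < ρ) hβm (by linarith : 0 < q) hmain hhom
  obtain ⟨B, hB, hsum⟩ := exists_tsum_tsum_shell_le hε hρ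
  set A : ℝ := C₀ ^ q * (4 ^ n * 4 ^ m) * 2 ^ q with hA
  have hA0 : 0 < A := by positivity
  refine ⟨A * B, by positivity, fun L a ham hsupp hbd hmean ↦ ?_⟩
  have hshell : ∀ k l : ℕ,
      ∫⁻ w in {w : EuclideanSpace ℝ (Fin n) × EuclideanSpace ℝ (Fin m) |
          ((2 : ℝ) ^ (L + ((k : ℤ) + 1) - 1) ≤ supAbs w.1 ∧
            supAbs w.1 < (2 : ℝ) ^ (L + ((k : ℤ) + 1))) ∧
          ((2 : ℝ) ^ (L + ((l : ℤ) + 1) - 1) ≤ supAbs w.2 ∧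
            supAbs w.2 < (2 : ℝ) ^ (L + ((l : ℤ) + 1)))},
        ENNReal.ofReal (|flagOp n m α β ρ a w| ^ q) ≤
      ENNReal.ofReal A * ENNReal.ofReal ((2 : ℝ) ^ (-ε * |(L : ℝ) + l - ρ * ((L : ℝ) + k)|) *
        ((1 / 2) ^ k + (1 / 2) ^ l)) := by
    intro k l
    have hlow : ∀ j : ℕ, (2 : ℝ) ^ (L + ((j : ℤ) + 1) - 1) = 2 ^ L * 2 ^ j := fun j ↦ by
      rw [← add_assoc, add_sub_cancel_right, zpow_add₀ two_ne_zero, zpow_natCast]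
    have hup : ∀ j : ℕ, (2 : ℝ) ^ (L + ((j : ℤ) + 1)) = 2 * (2 ^ L * 2 ^ j) := fun j ↦ by
      rw [← add_assoc, zpow_add_one₀ two_ne_zero, zpow_add₀ two_ne_zero, zpow_natCast]
      ring
    have hle : ∀ j : ℕ, (2 : ℝ) ^ L ≤ 2 ^ L * 2 ^ j := fun j ↦
      le_mul_of_one_le_right (by positivity) (one_le_pow₀ one_le_two)
    have hratio : ∀ j : ℕ, (2 : ℝ) ^ L / (2 ^ L * 2 ^ j) = (1 / 2) ^ j := fun j ↦ by
      rw [one_div_pow]; field_simp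
    have hrpow : ∀ j : ℕ, (2 : ℝ) ^ ((L : ℝ) + j) = 2 ^ L * 2 ^ j := fun j ↦ by
      rw [Real.rpow_add zero_lt_two, Real.rpow_intCast, Real.rpow_natCast]
    have hs := hscale ((L : ℝ) + k) ((L : ℝ) + l)
    simp only [hlow, hup]
    rw [hrpow, hrpow, Real.rpow_natCast, Real.rpow_natCast] at hs
    set X : ℝ := 2 ^ L * 2 ^ k with hX
    set Y : ℝ := 2 ^ L * 2 ^ l with hY
    have hX0 : 0 < X := by positivity
    have hY0 : 0 < Y := by positivity
    set P : ℝ := X ^ (α - n) * (X ^ ρ + Y) ^ (β - m) with hP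
    have hP0 : 0 < P := by positivity
    set D : ℝ := (1 / 2) ^ k + (1 / 2) ^ l with hD
    have hD0 : 0 < D := by positivity
    have hD2 : D ≤ 2 := by
      have h1 : ∀ j : ℕ, (1 / 2 : ℝ) ^ j ≤ 1 := fun j ↦ pow_le_one₀ (by norm_num) (by norm_num)
      linarith [h1 k, h1 l]
    have hDq : D ^ q ≤ 2 ^ q * D := by
      have h1 : (D / 2) ^ q ≤ D / 2 :=
        Real.rpow_le_self_of_le_one (by positivity) (by linarith) hq.le
      rw [Real.div_rpow hD0.le zero_le_two, div_le_iff₀ (by positivity)] at h1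
      have : 0 < (2 : ℝ) ^ q * D := by positivity
      linarith
    calc _ ≤ ∫⁻ _ in {w : EuclideanSpace ℝ (Fin n) × EuclideanSpace ℝ (Fin m) |
            (X ≤ supAbs w.1 ∧ supAbs w.1 < 2 * X) ∧ (Y ≤ supAbs w.2 ∧ supAbs w.2 < 2 * Y)},
          ENNReal.ofReal ((C₀ * (P * D)) ^ q) := by
          refine setLIntegral_mono measurable_const fun w hw ↦ ?_
          refine ENNReal.ofReal_le_ofReal (Real.rpow_le_rpow (abs_nonneg _) ?_ (by linarith))
          have := hpt L a ham hsupp hbd hmean X Y w (hle k) (hle l) hw.1.1 hw.1.2.le hw.2.1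
          rwa [hratio, hratio] at this
      _ ≤ ENNReal.ofReal ((C₀ * (P * D)) ^ q) *
          ENNReal.ofReal ((2 * (2 * X)) ^ n * (2 * (2 * Y)) ^ m) := by
          rw [setLIntegral_const, ← volume_supAbs_prod_le (by positivity) (by positivity)]
          refine mul_le_mul_right (measure_mono ?_) _
          exact fun w hw ↦ ⟨hw.1.2.le, hw.2.2.le⟩
      _ ≤ _ := by
          rw [← ENNReal.ofReal_mul (by positivity), ← ENNReal.ofReal_mul hA0.le]
          refine ENNReal.ofReal_le_ofReal ?_
          calc _ = C₀ ^ q * (4 ^ n * 4 ^ m) * (X ^ n * Y ^ m * P ^ q) * D ^ q := by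
                rw [Real.mul_rpow hC₀.le (by positivity), Real.mul_rpow hP0.le hD0.le,
                  show 2 * (2 * X) = 4 * X by ring, show 2 * (2 * Y) = 4 * Y by ring, mul_pow,
                  mul_pow]
                ring
            _ ≤ C₀ ^ q * (4 ^ n * 4 ^ m) *
                2 ^ (-ε * |(L : ℝ) + l - ρ * ((L : ℝ) + k)|) * (2 ^ q * D) := by
                gcongr
            _ = _ := by rw [hA]; ring
  calc _ ≤ ∑' (k : ℕ) (l : ℕ), ENNReal.ofReal A *
        ENNReal.ofReal ((2 : ℝ) ^ (-ε * |(L : ℝ) + l - ρ * ((L : ℝ) + k)|) *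
          ((1 / 2) ^ k + (1 / 2) ^ l)) :=
        ENNReal.tsum_le_tsum fun k ↦ ENNReal.tsum_le_tsum fun l ↦ hshell k l
    _ ≤ ENNReal.ofReal A * ENNReal.ofReal B := by
        simp_rw [ENNReal.tsum_mul_left]
        gcongr
        exact hsum L
    _ = _ := (ENNReal.ofReal_mul hA0.le).symm
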